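/- For real s > 1 and real m ∈ (−1,1), one has 1/(s−1/2)² − ∫₀^∞ λ f(m,λ)/(λ² + (s−1/2)²)² dλ = (1/(2s−1))·(ψ'(s+m/2) + ψ'(s−m/2)), where ψ' is the trigamma function and f(m,λ) = 4(1+e^{2πλ}cos(πm))/(e^{4πλ}+2e^{2πλ}cos(πm)+1). -/

import Mathlib

open MeasureTheory Real

/-- The function `f(m,λ)` from the identity contribution of the trace formula. -/
noncomputable def fId (m lam : ℝ) : ℝ :=
  4 * (1 + Real.exp (2 * π * lam) * Real.cos (π * m)) /
    (Real.exp (4 * π * lam) + 2 * Real.exp (2 * π * lam) * Real.cos (π * m) + 1)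

/-- The trigamma function `ψ'(x) = ∑_{k=0}^∞ 1/(k+x)²`. -/
noncomputable def trigamma (x : ℝ) : ℝ := ∑' k : ℕ, 1 / ((k : ℝ) + x) ^ 2

open Filter Topology Set

lemma tk_int (k : ℕ) {a : ℝ} (ha : 0 < a) :
    ∫ t in Ioi (0:ℝ), t ^ k * Real.exp (-(a * t)) = (1 / a) ^ (k + 1) * (k.factorial : ℝ) := by
  have h := Real.integral_rpow_mul_exp_neg_mul_Ioi (a := (k:ℝ) + 1) (r := a) (by positivity) ha
  rw [Real.Gamma_nat_eq_factorial] at h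
  have e : ((1 / a) ^ ((k:ℝ) + 1)) = (1 / a) ^ (k + 1) := by
    exact_mod_cast Real.rpow_natCast (1 / a) (k + 1)
  rw [e] at h
  rw [← h]
  simp [add_sub_cancel_right, Real.rpow_natCast]

lemma tk_integrable (k : ℕ) {a : ℝ} (ha : 0 < a) :
    IntegrableOn (fun t : ℝ => t ^ k * Real.exp (-(a * t))) (Ioi (0:ℝ)) := by
  apply Integrable.of_integral_ne_zero
  rw [tk_int k ha]
  positivity

lemma tk_tendsto (k : ℕ) {a : ℝ} (ha : 0 < a) :
    Tendsto (fun t : ℝ => t ^ k * Real.exp (-(a * t))) atTop (𝓝 0) := by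
  have h := tendsto_rpow_mul_exp_neg_mul_atTop_nhds_zero (k:ℝ) a ha
  simpa [Real.rpow_natCast] using h

lemma exp_sin_integral {b : ℝ} (hb : 0 < b) (t : ℝ) :
    ∫ l in Ioi (0:ℝ), Real.exp (-(b * l)) * Real.sin (l * t) = t / (t ^ 2 + b ^ 2) := by
  have hD : t ^ 2 + b ^ 2 ≠ 0 := by positivity
  have h := integral_Ioi_of_hasDerivAt_of_tendsto' (a := 0) (m := 0)
    (f := fun l : ℝ => Real.exp (-(b * l)) * (-(b * Real.sin (l * t) + t * Real.cos (l * t)) / (t ^ 2 + b ^ 2)))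
    (f' := fun l : ℝ => Real.exp (-(b * l)) * Real.sin (l * t)) ?_ ?_ ?_
  · rw [h]; simp; ring
  · intro x _
    have h1 : HasDerivAt (fun l : ℝ => Real.exp (-(b * l))) (Real.exp (-(b * x)) * (-b)) x := by
      have := ((hasDerivAt_id x).const_mul b).neg.exp
      simpa using this
    have h2 : HasDerivAt (fun l : ℝ => Real.sin (l * t)) (Real.cos (x * t) * t) x := by
      simpa using ((hasDerivAt_id x).mul_const t).sin
    have h3 : HasDerivAt (fun l : ℝ => Real.cos (l * t)) (-Real.sin (x * t) * t) x := by
      simpa using ((hasDerivAt_id x).mul_const t).cos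
    have := h1.mul ((((h2.const_mul b).add (h3.const_mul t)).neg).div_const (t ^ 2 + b ^ 2))
    refine this.congr_deriv ?_
    simp only [Pi.neg_apply, Pi.add_apply]
    field_simp
    ring
  · have := tk_integrable 0 hb
    simp only [pow_zero, one_mul] at this
    exact Integrable.mul_bdd (c := 1) this (by fun_prop) (by
      filter_upwards with x; simpa using Real.abs_sin_le_one _)
  · have := tk_tendsto 0 hb
    simp only [pow_zero, one_mul] at this
    refine squeeze_zero_norm (a := fun l => Real.exp (-(b * l)) * ((b + |t|) / (t ^ 2 + b ^ 2))) ?_ ?_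
    · intro l
      rw [norm_mul, Real.norm_eq_abs, Real.abs_exp, norm_div, Real.norm_eq_abs, abs_neg,
        Real.norm_eq_abs, abs_of_pos (a := t ^ 2 + b ^ 2) (by positivity)]
      gcongr
      refine (abs_add_le _ _).trans ?_
      rw [abs_mul, abs_mul, abs_of_pos hb]
      gcongr
      · exact mul_le_of_le_one_right hb.le (Real.abs_sin_le_one _)
      · exact mul_le_of_le_one_right (abs_nonneg _) (Real.abs_cos_le_one _)
    · simpa using this.mul_const _

lemma t_exp_sin_integral {z : ℝ} (hz : 0 < z) (l : ℝ) :
    ∫ t in Ioi (0:ℝ), t * Real.exp (-(z * t)) * Real.sin (l * t)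
      = 2 * z * l / (l ^ 2 + z ^ 2) ^ 2 := by
  have hD : l ^ 2 + z ^ 2 ≠ 0 := by positivity
  set D := l ^ 2 + z ^ 2 with hDdef
  have hDp : 0 < D := by positivity
  have h := integral_Ioi_of_hasDerivAt_of_tendsto' (a := 0) (m := 0)
    (f := fun t : ℝ => -((t * Real.exp (-(z * t))) * ((z * Real.sin (l * t) + l * Real.cos (l * t)) / D)
        + Real.exp (-(z * t)) * (((z ^ 2 - l ^ 2) * Real.sin (l * t) + 2 * z * l * Real.cos (l * t)) / D ^ 2)))
    (f' := fun t : ℝ => t * Real.exp (-(z * t)) * Real.sin (l * t)) ?_ ?_ ?_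
  · rw [h]; simp
  · intro x _
    have h1 : HasDerivAt (fun t : ℝ => Real.exp (-(z * t))) (Real.exp (-(z * x)) * (-z)) x := by
      have := ((hasDerivAt_id x).const_mul z).neg.exp
      simpa using this
    have h2 : HasDerivAt (fun t : ℝ => Real.sin (l * t)) (Real.cos (l * x) * l) x := by
      simpa using ((hasDerivAt_id x).const_mul l).sin
    have h3 : HasDerivAt (fun t : ℝ => Real.cos (l * t)) (-Real.sin (l * x) * l) x := by
      simpa using ((hasDerivAt_id x).const_mul l).cos
    have h0 : HasDerivAt (fun t : ℝ => t) 1 x := hasDerivAt_id x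
    have := (((h0.mul h1).mul (((h2.const_mul z).add (h3.const_mul l)).div_const D)).add
      (h1.mul (((h2.const_mul (z ^ 2 - l ^ 2)).add (h3.const_mul (2 * z * l))).div_const (D ^ 2)))).neg
    refine this.congr_deriv ?_
    simp only [Pi.neg_apply, Pi.add_apply, Pi.mul_apply]
    field_simp
    rw [hDdef]
    ring
  · have := tk_integrable 1 hz
    simp only [pow_one] at this
    exact Integrable.mul_bdd (c := 1) this (by fun_prop) (by
      filter_upwards with x; simpa using Real.abs_sin_le_one _)
  · have hbd : ∀ A B C : ℝ, ∀ u, ‖(A * Real.sin u + B * Real.cos u) / C‖ ≤ (|A| + |B|) / |C| := by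
      intro A B C u
      rw [norm_div, Real.norm_eq_abs, Real.norm_eq_abs]
      gcongr
      refine (abs_add_le _ _).trans ?_
      rw [abs_mul, abs_mul]
      gcongr
      · exact mul_le_of_le_one_right (abs_nonneg _) (Real.abs_sin_le_one _)
      · exact mul_le_of_le_one_right (abs_nonneg _) (Real.abs_cos_le_one _)
    have t1 := tk_tendsto 1 hz
    have t0 := tk_tendsto 0 hz
    simp only [pow_one, pow_zero, one_mul] at t0 t1
    have e1 := t1.zero_mul_isBoundedUnder_le (g := fun t => (z * Real.sin (l * t) + l * Real.cos (l * t)) / D)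
      (isBoundedUnder_of ⟨_, fun t => hbd z l D (l * t)⟩)
    have e0 := t0.zero_mul_isBoundedUnder_le (g := fun t => ((z ^ 2 - l ^ 2) * Real.sin (l * t) + 2 * z * l * Real.cos (l * t)) / D ^ 2)
      (isBoundedUnder_of ⟨_, fun t => hbd (z ^ 2 - l ^ 2) (2 * z * l) (D ^ 2) (l * t)⟩)
    simpa using (e1.add e0).neg

lemma J_eq {z b : ℝ} (hz : 0 < z) (hb : 0 < b) :
    ∫ l in Ioi (0:ℝ), l * Real.exp (-(b * l)) / (l ^ 2 + z ^ 2) ^ 2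
      = (1 / (2 * z)) * ∫ t in Ioi (0:ℝ), t ^ 2 * Real.exp (-(z * t)) / (t ^ 2 + b ^ 2) := by
  have hsw := integral_integral_swap (μ := volume.restrict (Ioi (0:ℝ)))
    (ν := volume.restrict (Ioi (0:ℝ)))
    (f := fun l t : ℝ => (Real.exp (-(b * l)) * (t * Real.exp (-(z * t)))) * Real.sin (l * t)) ?_
  · have hL : ∀ l : ℝ, ∫ t in Ioi (0:ℝ), (Real.exp (-(b * l)) * (t * Real.exp (-(z * t)))) * Real.sin (l * t)
        = (2 * z) * (l * Real.exp (-(b * l)) / (l ^ 2 + z ^ 2) ^ 2) := by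
      intro l
      simp_rw [mul_assoc (Real.exp (-(b * l)))]
      rw [integral_const_mul, t_exp_sin_integral hz]
      ring
    have hR : ∀ t : ℝ, ∫ l in Ioi (0:ℝ), (Real.exp (-(b * l)) * (t * Real.exp (-(z * t)))) * Real.sin (l * t)
        = t ^ 2 * Real.exp (-(z * t)) / (t ^ 2 + b ^ 2) := by
      intro t
      have : ∀ l : ℝ, (Real.exp (-(b * l)) * (t * Real.exp (-(z * t)))) * Real.sin (l * t)
        = (t * Real.exp (-(z * t))) * (Real.exp (-(b * l)) * Real.sin (l * t)) := by intro l; ring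
      simp_rw [this]
      rw [integral_const_mul, exp_sin_integral hb]
      ring
    simp_rw [hL, hR] at hsw
    rw [integral_const_mul] at hsw
    rw [← hsw, ← mul_assoc, one_div, inv_mul_cancel₀ (by positivity), one_mul]
  · have i0 := tk_integrable 0 hb
    have i1 := tk_integrable 1 hz
    simp only [pow_one, pow_zero, one_mul] at i0 i1
    have := Integrable.mul_prod i0 i1
    exact Integrable.mul_bdd (c := 1) this (by fun_prop) (by
      filter_upwards with x; simpa using Real.abs_sin_le_one _)

lemma fId_hasSum (m : ℝ) {l : ℝ} (hl : 0 < l) :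
    HasSum (fun n : ℕ => (4 * (-1) ^ n * Real.cos (π * (n + 1) * m))
      * Real.exp (-(2 * π * (n + 1) * l))) (fId m l) := by
  set v : ℂ := Complex.exp ((-(2 * π * l) : ℝ) + (π * m : ℝ) * Complex.I) with hv
  have hnv : ‖v‖ = Real.exp (-(2 * π * l)) := by
    rw [hv, Complex.norm_exp]; simp
  have hlt : Real.exp (-(2 * π * l)) < 1 := by
    rw [Real.exp_lt_one_iff]
    have : 0 < 2 * π * l := by positivity
    linarith
  have h := hasSum_geometric_of_norm_lt_one (ξ := -v) (by rw [norm_neg, hnv]; exact hlt)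
  have h2 := Complex.hasSum_re (h.mul_left (4 * v))
  convert! h2 using 1
  · ext n
    have : 4 * v * (-v) ^ n = ((4 * (-1) ^ n : ℝ) : ℂ) *
        Complex.exp ((-(2 * π * (n + 1) * l) : ℝ) + (π * (n + 1) * m : ℝ) * Complex.I) := by
      rw [neg_pow, mul_mul_mul_comm, mul_comm v, ← mul_assoc, mul_assoc, ← pow_succ, hv,
        ← Complex.exp_nat_mul]
      push_cast
      congr 2
      ring
    rw [this, Complex.re_ofReal_mul, Complex.exp_re]
    simp
    ring
  · have hre : v.re = Real.exp (-(2 * π * l)) * Real.cos (π * m) := by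
      rw [hv, Complex.exp_re]; simp
    have him : v.im = Real.exp (-(2 * π * l)) * Real.sin (π * m) := by
      rw [hv, Complex.exp_im]; simp
    have e1 : Real.exp (2 * π * l) = (Real.exp (-(2 * π * l)))⁻¹ := by
      rw [Real.exp_neg, inv_inv]
    have e2 : Real.exp (4 * π * l) = (Real.exp (-(2 * π * l)))⁻¹ ^ 2 := by
      rw [← e1, ← Real.exp_nat_mul]; congr 1; push_cast; ring
    unfold fId
    rw [e1, e2]
    have hq : 0 < Real.exp (-(2 * π * l)) := Real.exp_pos _
    generalize Real.exp (-(2 * π * l)) = q at *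
    have hsc := Real.sin_sq_add_cos_sq (π * m)
    have hc1 := Real.neg_one_le_cos (π * m)
    generalize Real.cos (π * m) = c at *
    generalize Real.sin (π * m) = d at *
    have hpos : 0 < 1 + 2 * q * c + q ^ 2 := by nlinarith [mul_nonneg hq.le (by linarith : 0 ≤ c + 1), mul_pos (sub_pos.2 hlt) (sub_pos.2 hlt)]
    have hN : Complex.normSq (1 + v) = 1 + 2 * q * c + q ^ 2 := by
      rw [Complex.normSq_apply]
      simp [hre, him]
      linear_combination q ^ 2 * hsc
    rw [sub_neg_eq_add, ← div_eq_mul_inv (4 * v), Complex.div_re, hN]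
    simp [hre, him]
    have hpos' : 1 + 2 * q * c + q ^ 2 ≠ 0 := hpos.ne'
    have hne : (q ^ 2)⁻¹ + 2 * q⁻¹ * c + 1 ≠ 0 := by
      have : (q ^ 2)⁻¹ + 2 * q⁻¹ * c + 1 = (1 + 2 * q * c + q ^ 2) / q ^ 2 := by field_simp
      rw [this]; positivity
    rw [← add_div, div_eq_div_iff hne hpos']
    field_simp
    linear_combination (-(q * (1 + 2 * q * c + q ^ 2))) * hsc

lemma coeff_int {t : ℝ} (ht : 0 < t) (n : ℤ) :
    ∫ y in (0:ℝ)..1, Complex.exp (-(2 * π * Complex.I * n) * y) * (Real.cosh (t * (y - 1 / 2)) : ℂ)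
      = ((Real.sinh (t / 2) * (2 * t / (t ^ 2 + (2 * π * n) ^ 2)) : ℝ) : ℂ) := by
  have hc1 : ((t:ℂ) - 2 * π * Complex.I * n) ≠ 0 := by
    intro h
    have := congrArg Complex.re h
    simp at this
    linarith
  have hc2 : (-(t:ℂ) - 2 * π * Complex.I * n) ≠ 0 := by
    intro h
    have := congrArg Complex.re h
    simp at this
    linarith
  have hper : Complex.exp (-(2 * π * Complex.I * n)) = 1 := by
    rw [Complex.exp_eq_one_iff]
    exact ⟨-n, by push_cast; ring⟩
  have e : ∀ y : ℝ, Complex.exp (-(2 * π * Complex.I * n) * y) * (Real.cosh (t * (y - 1 / 2)) : ℂ)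
      = Complex.exp (-(t / 2 : ℂ)) / 2 * Complex.exp (((t:ℂ) - 2 * π * Complex.I * n) * y)
        + Complex.exp ((t / 2 : ℂ)) / 2 * Complex.exp ((-(t:ℂ) - 2 * π * Complex.I * n) * y) := by
    intro y
    rw [Real.cosh_eq]
    push_cast
    rw [div_mul_eq_mul_div, div_mul_eq_mul_div, ← Complex.exp_add, ← Complex.exp_add, ← add_div,
      mul_div_assoc', mul_add, ← Complex.exp_add, ← Complex.exp_add]
    congr 3 <;> ring
  simp_rw [e]
  rw [intervalIntegral.integral_add (Continuous.intervalIntegrable (by fun_prop) _ _)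
    (Continuous.intervalIntegrable (by fun_prop) _ _),
    intervalIntegral.integral_const_mul, intervalIntegral.integral_const_mul,
    integral_exp_mul_complex hc1, integral_exp_mul_complex hc2]
  have x1 : Complex.exp (((t:ℂ) - 2 * π * Complex.I * n) * (1:ℝ)) = Complex.exp (t / 2) * Complex.exp (t / 2) := by
    rw [Complex.ofReal_one, mul_one, sub_eq_add_neg, Complex.exp_add, hper, mul_one, ← Complex.exp_add]
    congr 1; ring
  have x2 : Complex.exp ((-(t:ℂ) - 2 * π * Complex.I * n) * (1:ℝ)) = Complex.exp (-(t / 2)) * Complex.exp (-(t / 2)) := by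
    rw [Complex.ofReal_one, mul_one, sub_eq_add_neg, Complex.exp_add, hper, mul_one, ← Complex.exp_add]
    congr 1; ring
  rw [x1, x2, Real.sinh_eq]
  push_cast
  have x3 : Complex.exp (t / 2) * Complex.exp (-(t / 2)) = 1 := by
    rw [← Complex.exp_add]; simp
  have hD : ((t:ℂ) ^ 2 + (2 * π * n) ^ 2) = -(((t:ℂ) - 2 * π * Complex.I * n) * (-(t:ℂ) - 2 * π * Complex.I * n)) := by
    linear_combination (4 * π ^ 2 * n ^ 2 : ℂ) * Complex.I_sq
  rw [hD]
  simp only [Complex.ofReal_zero, mul_zero, Complex.exp_zero]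
  generalize Complex.exp (t / 2) = A at *
  generalize Complex.exp (-(t / 2)) = B at *
  field_simp
  linear_combination (-A * t + B * t - 2 * π * Complex.I * n * (A + B)) * x3

lemma cosh_fourier {t m : ℝ} (ht : 0 < t) (hm1 : -1 < m) (hm2 : m < 1) :
    HasSum (fun n : ℕ => (4 * (-1) ^ n * Real.cos (π * (n + 1) * m))
      * (t / (t ^ 2 + (2 * π * (n + 1)) ^ 2)))
      (2 / t - Real.cosh (m * t / 2) / Real.sinh (t / 2)) := by
  have hsh : 0 < Real.sinh (t / 2) := Real.sinh_pos_iff.2 (by positivity)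
  let g : ℝ → ℂ := fun y => (Real.cosh (t * (y - 1 / 2)) : ℂ)
  have hgc : Continuous g := by fun_prop
  let B : C(UnitAddCircle, ℂ) := ContinuousMap.mk (AddCircle.liftIco 1 0 g)
    (AddCircle.liftIco_zero_continuous (by
      simp only [g]; rw [← Real.cosh_neg]; congr 2; ring) hgc.continuousOn)
  have hcoef : ∀ n : ℤ, fourierCoeff B n
      = ((Real.sinh (t / 2) * (2 * t / (t ^ 2 + (2 * π * n) ^ 2)) : ℝ) : ℂ) := by
    intro n
    rw [← coeff_int ht n]
    change fourierCoeff (AddCircle.liftIco 1 0 g) n = _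
    rw [fourierCoeff_liftIco_eq, fourierCoeffOn_eq_integral]
    simp only [zero_add, sub_zero, div_one, one_smul]
    refine intervalIntegral.integral_congr fun y _ => ?_
    simp only [fourier_coe_apply, smul_eq_mul, g]
    congr 2
    push_cast
    ring
  have hsum : Summable (fourierCoeff B) := by
    have h1 : Summable (fun n : ℤ => (Real.sinh (t / 2) * (2 * t) / (2 * π) ^ 2) * (1 / (n:ℝ) ^ 2)) :=
      (Real.summable_one_div_int_pow.2 (by norm_num)).mul_left _
    refine Summable.of_norm_bounded_eventually h1 ?_
    have : ({0}ᶜ : Set ℤ) ∈ (cofinite : Filter ℤ) := (Set.finite_singleton (0:ℤ)).compl_mem_cofinite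
    filter_upwards [this] with n hn
    have hn0 : (n:ℝ) ≠ 0 := by exact_mod_cast hn
    rw [hcoef, Complex.norm_real, Real.norm_eq_abs, abs_of_nonneg (by positivity)]
    rw [div_mul_div_comm, mul_one, ← mul_pow, mul_div_assoc (Real.sinh (t / 2))]
    gcongr
    nlinarith
  have h0 := has_pointwise_sum_fourier_series_of_summable hsum (((m + 1) / 2 : ℝ) : UnitAddCircle)
  have hval : B (((m + 1) / 2 : ℝ) : UnitAddCircle) = (Real.cosh (m * t / 2) : ℂ) := by
    change AddCircle.liftIco 1 0 g _ = _
    rw [AddCircle.liftIco_coe_apply (by constructor <;> linarith)]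
    simp only [g]
    congr 2; ring
  rw [hval] at h0
  have h1 := Complex.hasSum_re h0.nat_add_neg
  rw [← hasSum_nat_add_iff' 1] at h1
  have h2 := h1.mul_left (-(1 / Real.sinh (t / 2)))
  have hf : ∀ k : ℤ, (fourierCoeff B k • fourier k (((m + 1) / 2 : ℝ) : UnitAddCircle)).re
      = (Real.sinh (t / 2) * (2 * t / (t ^ 2 + (2 * π * k) ^ 2))) * Real.cos (π * k * (m + 1)) := by
    intro k
    rw [hcoef, smul_eq_mul, Complex.re_ofReal_mul, fourier_coe_apply]
    have : (2 * π * Complex.I * k * (((m + 1) / 2 : ℝ) : ℂ) / (1:ℝ)) = ((π * k * (m + 1) : ℝ) : ℂ) * Complex.I := by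
      push_cast; ring
    rw [this, Complex.exp_ofReal_mul_I_re]
  convert! h2 using 1
  · ext n
    rw [Complex.add_re, hf, hf]
    have hcos : Real.cos (π * (n + 1) * (m + 1)) = -((-1) ^ n * Real.cos (π * (n + 1) * m)) := by
      have : π * (n + 1) * (m + 1) = π * (n + 1) * m + ((n + 1 : ℕ) : ℝ) * π := by push_cast; ring
      rw [this, Real.cos_add_nat_mul_pi, pow_succ]; ring
    have hcos2 : Real.cos (π * (-(n + 1)) * (m + 1)) = -((-1) ^ n * Real.cos (π * (n + 1) * m)) := by
      rw [← hcos, ← Real.cos_neg]; congr 1; ring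
    push_cast
    rw [hcos, hcos2]
    have : t ^ 2 + (2 * π * (n + 1)) ^ 2 ≠ 0 := by positivity
    rw [show (2 * π * -((n:ℝ) + 1)) ^ 2 = (2 * π * (n + 1)) ^ 2 by ring]
    field_simp
    ring
  · simp only [Finset.range_one, Finset.sum_singleton, Nat.cast_zero, neg_zero, Complex.add_re,
      Complex.ofReal_re, hf, Int.cast_zero, mul_zero, zero_mul, Real.cos_zero, mul_one]
    field_simp
    ring

lemma swap_lemma (F : ℕ → ℝ → ℝ) (G : ℝ → ℝ)
    (hF : ∀ n, IntegrableOn (F n) (Ioi (0:ℝ)))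
    (hs : Summable fun n => ∫ t in Ioi (0:ℝ), ‖F n t‖)
    (hG : ∀ t, 0 < t → HasSum (fun n => F n t) (G t)) :
    HasSum (fun n => ∫ t in Ioi (0:ℝ), F n t) (∫ t in Ioi (0:ℝ), G t) := by
  have h := hasSum_integral_of_summable_integral_norm hF hs
  have e : ∫ t in Ioi (0:ℝ), ∑' n, F n t = ∫ t in Ioi (0:ℝ), G t :=
    setIntegral_congr_fun measurableSet_Ioi fun t ht => (hG t ht).tsum_eq
  rwa [e] at h

lemma summable_sq_shift (C : ℝ) : Summable (fun n : ℕ => C * (1 / ((n:ℝ) + 1) ^ 2)) := by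
  have h := (summable_nat_add_iff (f := fun n : ℕ => 1 / (n:ℝ) ^ 2) 1).2
    (Real.summable_one_div_nat_pow.2 (by norm_num))
  exact (by simpa using h : Summable (fun n : ℕ => 1 / ((n:ℝ) + 1) ^ 2)).mul_left C

lemma coef_le (m : ℝ) (n : ℕ) : ‖(4 * (-1) ^ n * Real.cos (π * (n + 1) * m) : ℝ)‖ ≤ 4 := by
  rw [norm_mul, norm_mul, norm_pow]
  simp only [norm_neg, norm_one, one_pow, mul_one, Real.norm_eq_abs]
  rw [abs_of_pos (by norm_num : (0:ℝ) < 4)]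
  have := Real.abs_cos_le_one (π * (n + 1) * m)
  linarith

/-- Domination: scaled nonneg functions bounded by an integrable function. -/
lemma dom_lemma (c : ℝ) (hc : ‖c‖ ≤ 4) (g h : ℝ → ℝ) (hh : IntegrableOn h (Ioi (0:ℝ)))
    (hgm : Measurable g) (hgh : ∀ t, 0 < t → 0 ≤ g t ∧ g t ≤ h t) :
    IntegrableOn (fun t => c * g t) (Ioi (0:ℝ)) ∧
      ∫ t in Ioi (0:ℝ), ‖c * g t‖ ≤ 4 * ∫ t in Ioi (0:ℝ), h t := by
  have hg : IntegrableOn g (Ioi (0:ℝ)) := by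
    refine Integrable.mono' hh hgm.aestronglyMeasurable ?_
    filter_upwards [ae_restrict_mem measurableSet_Ioi] with t ht
    rw [Real.norm_eq_abs, abs_of_nonneg (hgh t ht).1]
    exact (hgh t ht).2
  have hcg : IntegrableOn (fun t => c * g t) (Ioi (0:ℝ)) := Integrable.const_mul hg c
  refine ⟨hcg, ?_⟩
  rw [← integral_const_mul]
  refine setIntegral_mono_on hcg.norm (Integrable.const_mul hh 4) measurableSet_Ioi ?_
  intro t ht
  rw [norm_mul]
  have h1 := (hgh t ht)
  rw [Real.norm_eq_abs (g t), abs_of_nonneg h1.1]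
  exact mul_le_mul hc h1.2 h1.1 (by norm_num)

lemma first_sum (m : ℝ) {z : ℝ} (hz : 0 < z) :
    HasSum (fun n : ℕ => ∫ l in Ioi (0:ℝ), (4 * (-1) ^ n * Real.cos (π * (n + 1) * m))
        * (l * Real.exp (-((2 * π * (n + 1)) * l)) / (l ^ 2 + z ^ 2) ^ 2))
      (∫ l in Ioi (0:ℝ), l * fId m l / (l ^ 2 + z ^ 2) ^ 2) := by
  have key : ∀ n : ℕ, _ := fun n : ℕ => dom_lemma _ (coef_le m n)
      (fun l => l * Real.exp (-((2 * π * (n + 1)) * l)) / (l ^ 2 + z ^ 2) ^ 2)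
      (fun l => (1 / z ^ 4) * (l ^ 1 * Real.exp (-((2 * π * (n + 1)) * l))))
      (Integrable.const_mul (tk_integrable 1 (a := 2 * π * ((n:ℝ) + 1)) (by positivity)) _)
      (by fun_prop) (by
        intro t ht
        refine ⟨by positivity, ?_⟩
        rw [pow_one, one_div, ← div_eq_inv_mul]
        gcongr
        nlinarith [mul_nonneg (sq_nonneg t) (sq_nonneg z), sq_nonneg (t ^ 2)])
  refine swap_lemma _ _ (fun n => (key n).1) ?_ ?_
  · refine Summable.of_nonneg_of_le (fun n => integral_nonneg fun _ => norm_nonneg _)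
      (fun n => (key n).2) ?_
    refine (summable_sq_shift (4 * (1 / z ^ 4) * (1 / (2 * π) ^ 2))).congr fun n => ?_
    rw [integral_const_mul, tk_int 1 (by positivity)]
    simp
    field_simp
  · intro l hl
    have := (fId_hasSum m hl).mul_left (l / (l ^ 2 + z ^ 2) ^ 2)
    convert! this using 1
    · ext n; ring
    · ring

lemma second_sum {m z : ℝ} (hm1 : -1 < m) (hm2 : m < 1) (hz : 0 < z) :
    HasSum (fun n : ℕ => ∫ t in Ioi (0:ℝ), (4 * (-1) ^ n * Real.cos (π * (n + 1) * m))
        * (t ^ 2 * Real.exp (-(z * t)) / (t ^ 2 + (2 * π * (n + 1)) ^ 2)))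
      (∫ t in Ioi (0:ℝ), (t * Real.exp (-(z * t))) *
        (2 / t - Real.cosh (m * t / 2) / Real.sinh (t / 2))) := by
  have key : ∀ n : ℕ, _ := fun n : ℕ => dom_lemma _ (coef_le m n)
      (fun t => t ^ 2 * Real.exp (-(z * t)) / (t ^ 2 + (2 * π * (n + 1)) ^ 2))
      (fun t => (1 / (2 * π * (n + 1)) ^ 2) * (t ^ 2 * Real.exp (-(z * t))))
      (Integrable.const_mul (tk_integrable 2 hz) _)
      (by fun_prop) (by
        intro t ht
        refine ⟨by positivity, ?_⟩
        rw [one_div, ← div_eq_inv_mul]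
        gcongr
        nlinarith [sq_nonneg t])
  refine swap_lemma _ _ (fun n => (key n).1) ?_ ?_
  · refine Summable.of_nonneg_of_le (fun n => integral_nonneg fun _ => norm_nonneg _)
      (fun n => (key n).2) ?_
    refine (summable_sq_shift (4 * (1 / (2 * π) ^ 2) * ((1 / z) ^ 3 * 2))).congr fun n => ?_
    rw [integral_const_mul, tk_int 2 hz]
    simp
    field_simp
  · intro t ht
    have := (cosh_fourier ht hm1 hm2).mul_left (t * Real.exp (-(z * t)))
    convert! this using 1
    ext n; ring

lemma trigamma_summable {x : ℝ} (hx : 0 < x) : Summable fun k : ℕ => 1 / ((k:ℝ) + x) ^ 2 := by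
  have h := (Real.summable_one_div_nat_add_rpow x 2).2 (by norm_num)
  refine h.congr fun k => ?_
  rw [abs_of_pos (by positivity)]
  norm_cast

lemma third_sum {m z : ℝ} (hm1 : -1 < m) (hm2 : m < 1) (hz : 1 / 2 < z) :
    ∫ t in Ioi (0:ℝ), (t * Real.exp (-(z * t))) * (Real.cosh (m * t / 2) / Real.sinh (t / 2))
      = trigamma (z + 1 / 2 + m / 2) + trigamma (z + 1 / 2 - m / 2) := by
  have hp1 : 0 < z + 1 / 2 + m / 2 := by linarith
  have hp2 : 0 < z + 1 / 2 - m / 2 := by linarith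
  set p := z + 1 / 2 + m / 2 with hp
  set r := z + 1 / 2 - m / 2 with hr
  have hI : ∀ k : ℕ, ∀ x : ℝ, 0 < x →
      IntegrableOn (fun t : ℝ => t ^ 1 * Real.exp (-(((k:ℝ) + x) * t))) (Ioi (0:ℝ)) :=
    fun k x hx => tk_integrable 1 (by positivity)
  have hV : ∀ k : ℕ, ∫ t in Ioi (0:ℝ), (t ^ 1 * Real.exp (-(((k:ℝ) + p) * t))
      + t ^ 1 * Real.exp (-(((k:ℝ) + r) * t))) = 1 / ((k:ℝ) + p) ^ 2 + 1 / ((k:ℝ) + r) ^ 2 := by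
    intro k
    rw [integral_add (hI k p hp1) (hI k r hp2), tk_int 1 (by positivity), tk_int 1 (by positivity)]
    simp
  have hS := (trigamma_summable hp1).hasSum.add (trigamma_summable hp2).hasSum
  have h := swap_lemma (fun k t => t ^ 1 * Real.exp (-(((k:ℝ) + p) * t))
      + t ^ 1 * Real.exp (-(((k:ℝ) + r) * t)))
    (fun t => (t * Real.exp (-(z * t))) * (Real.cosh (m * t / 2) / Real.sinh (t / 2)))
    (fun k => (hI k p hp1).add (hI k r hp2)) ?_ ?_
  · simp_rw [hV] at h
    exact h.unique hS
  · refine hS.summable.congr fun k => ?_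
    rw [← hV k]
    refine setIntegral_congr_fun measurableSet_Ioi fun t ht => ?_
    have ht' : 0 < t := ht
    rw [Real.norm_eq_abs, abs_of_nonneg (by positivity)]
  · intro t ht
    have hg := hasSum_geometric_of_lt_one (r := Real.exp (-t)) (Real.exp_pos _).le
      (by rw [Real.exp_lt_one_iff]; linarith)
    have := hg.mul_left (t * (Real.exp (-(p * t)) + Real.exp (-(r * t))))
    convert! this using 1
    · ext k
      have x1 : Real.exp (-(((k:ℝ) + p) * t)) = Real.exp (-(p * t)) * Real.exp (-t) ^ k := by
        rw [← Real.exp_nat_mul, ← Real.exp_add]; congr 1; ring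
      have x2 : Real.exp (-(((k:ℝ) + r) * t)) = Real.exp (-(r * t)) * Real.exp (-t) ^ k := by
        rw [← Real.exp_nat_mul, ← Real.exp_add]; congr 1; ring
      rw [x1, x2]; ring
    · rw [Real.cosh_eq, Real.sinh_eq]
      have e1 : Real.exp (-(p * t)) = Real.exp (-(z * t)) * Real.exp (-(t / 2)) * Real.exp (-(m * t / 2)) := by
        rw [← Real.exp_add, ← Real.exp_add]; congr 1; rw [hp]; ring
      have e2 : Real.exp (-(r * t)) = Real.exp (-(z * t)) * Real.exp (-(t / 2)) * Real.exp (m * t / 2) := by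
        rw [← Real.exp_add, ← Real.exp_add]; congr 1; rw [hr]; ring
      have e3 : Real.exp (-t) = Real.exp (-(t / 2)) * Real.exp (-(t / 2)) := by
        rw [← Real.exp_add]; congr 1; ring
      have e4 : Real.exp (t / 2) = (Real.exp (-(t / 2)))⁻¹ := by rw [Real.exp_neg, inv_inv]
      have hlt : Real.exp (-(t / 2)) < 1 := by rw [Real.exp_lt_one_iff]; linarith
      rw [e1, e2, e3, e4]
      have hq : 0 < Real.exp (-(t / 2)) := Real.exp_pos _
      generalize Real.exp (-(t / 2)) = q at *
      have h1 : 1 - q * q ≠ 0 := by nlinarith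
      have h1' : 1 - q ^ 2 ≠ 0 := by nlinarith
      have h2 : q⁻¹ - q = (1 - q * q) / q := by field_simp
      rw [h2]
      field_simp
      ring

lemma trigamma_pos {x : ℝ} (hx : 0 < x) : 0 < trigamma x := by
  refine (trigamma_summable hx).tsum_pos (fun k => by positivity) 0 (by positivity)

theorem stmt_9 (s m : ℝ) (hs : 1 < s) (hm1 : -1 < m) (hm2 : m < 1) :
    1 / (s - 1 / 2) ^ 2 -
      ∫ lam in Set.Ioi (0 : ℝ), lam * fId m lam / (lam ^ 2 + (s - 1 / 2) ^ 2) ^ 2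
    = (1 / (2 * s - 1)) * (trigamma (s + m / 2) + trigamma (s - m / 2)) := by
  obtain ⟨z, rfl⟩ : ∃ z, s = z + 1 / 2 := ⟨s - 1 / 2, by ring⟩
  have hz : 1 / 2 < z := by linarith
  have hz0 : 0 < z := by linarith
  have hA := first_sum m hz0
  have hB := (second_sum hm1 hm2 hz0).mul_left (1 / (2 * z))
  have hterm : ∀ n : ℕ, ∫ l in Ioi (0:ℝ), (4 * (-1) ^ n * Real.cos (π * (n + 1) * m))
        * (l * Real.exp (-((2 * π * (n + 1)) * l)) / (l ^ 2 + z ^ 2) ^ 2)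
      = 1 / (2 * z) * ∫ t in Ioi (0:ℝ), (4 * (-1) ^ n * Real.cos (π * (n + 1) * m))
        * (t ^ 2 * Real.exp (-(z * t)) / (t ^ 2 + (2 * π * (n + 1)) ^ 2)) := by
    intro n
    rw [integral_const_mul, integral_const_mul, J_eq hz0 (by positivity)]
    ring
  simp_rw [hterm] at hA
  have hAB := hA.unique hB
  have hT := third_sum hm1 hm2 hz
  have hTi : IntegrableOn (fun t : ℝ => (t * Real.exp (-(z * t))) *
      (Real.cosh (m * t / 2) / Real.sinh (t / 2))) (Ioi (0:ℝ)) := by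
    apply Integrable.of_integral_ne_zero
    rw [hT]
    have h1 := trigamma_pos (x := z + 1 / 2 + m / 2) (by linarith)
    have h2 := trigamma_pos (x := z + 1 / 2 - m / 2) (by linarith)
    positivity
  have hK : ∫ t in Ioi (0:ℝ), (t * Real.exp (-(z * t))) *
        (2 / t - Real.cosh (m * t / 2) / Real.sinh (t / 2))
      = 2 / z - (trigamma (z + 1 / 2 + m / 2) + trigamma (z + 1 / 2 - m / 2)) := by
    rw [← hT]
    have h2 : ∫ t in Ioi (0:ℝ), 2 * (t ^ 0 * Real.exp (-(z * t))) = 2 / z := by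
      rw [integral_const_mul, tk_int 0 hz0]; simp; ring
    rw [← h2, ← integral_sub (Integrable.const_mul (tk_integrable 0 hz0) 2) hTi]
    refine setIntegral_congr_fun measurableSet_Ioi fun t ht => ?_
    have ht' : t ≠ 0 := ne_of_gt ht
    simp only [pow_zero, one_mul, mul_sub]
    congr 1
    field_simp
  rw [hK] at hAB
  rw [show z + 1 / 2 - 1 / 2 = z by ring, show 2 * (z + 1 / 2) - 1 = 2 * z by ring, hAB]
  field_simp
  ring
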